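/- (Generalized Kasner exponents tend to 1/3, Theorem 4.1.) Let (η, λ, r, s) be a regular solution on [1,∞). Then, uniformly in x ∈ ℝ as t → ∞, t·∂ₜλ(t,x) / (t·∂ₜλ(t,x) + 2) → 1/3 and 1 / (t·∂ₜλ(t,x) + 2) → 1/3; i.e., for every ε > 0 there exists t₀ ≥ 1 such that for all t ≥ t₀ and all x ∈ ℝ both quantities are within ε of 1/3. -/

import Mathlib

open Real Set MeasureTheory

noncomputable section

/-- Partial derivative with respect to the time variable `t`. -/
def pderivT (f : ℝ → ℝ → ℝ) (t x : ℝ) : ℝ := deriv (fun τ => f τ x) t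

/-- Partial derivative with respect to the space variable `x`. -/
def pderivX (f : ℝ → ℝ → ℝ) (t x : ℝ) : ℝ := deriv (fun y => f t y) x

/-- The time interval `[1, T)` for a (possibly infinite) final time `T ∈ (1,∞]`. -/
def timeSlab (T : EReal) : Set ℝ := {t : ℝ | 1 ≤ t ∧ (t : EReal) < T}

/-- A regular solution of the plane-symmetric Einstein–stiff fluid equations in areal
coordinates, with cosmological constant `Λ`, on a time interval `J`:
continuously differentiable functions `η, λ, r, s`, 1-periodic in the space variable,
with `r ≥ 0`, `s ≥ 0`, satisfying the evolution and constraint equations (E1)–(E5). -/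
structure RegularSolution (Λ : ℝ) (J : Set ℝ) where
  η : ℝ → ℝ → ℝ
  lam : ℝ → ℝ → ℝ
  r : ℝ → ℝ → ℝ
  s : ℝ → ℝ → ℝ
  η_c1 : ContDiffOn ℝ 1 (fun p : ℝ × ℝ => η p.1 p.2) (J ×ˢ (Set.univ : Set ℝ))
  lam_c1 : ContDiffOn ℝ 1 (fun p : ℝ × ℝ => lam p.1 p.2) (J ×ˢ (Set.univ : Set ℝ))
  r_c1 : ContDiffOn ℝ 1 (fun p : ℝ × ℝ => r p.1 p.2) (J ×ˢ (Set.univ : Set ℝ))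
  s_c1 : ContDiffOn ℝ 1 (fun p : ℝ × ℝ => s p.1 p.2) (J ×ˢ (Set.univ : Set ℝ))
  η_per : ∀ t ∈ J, ∀ x : ℝ, η t (x + 1) = η t x
  lam_per : ∀ t ∈ J, ∀ x : ℝ, lam t (x + 1) = lam t x
  r_per : ∀ t ∈ J, ∀ x : ℝ, r t (x + 1) = r t x
  s_per : ∀ t ∈ J, ∀ x : ℝ, s t (x + 1) = s t x
  r_nonneg : ∀ t ∈ J, ∀ x : ℝ, 0 ≤ r t x
  s_nonneg : ∀ t ∈ J, ∀ x : ℝ, 0 ≤ s t x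
  eqE1 : ∀ t ∈ J, ∀ x : ℝ,
    Real.exp (-2 * η t x) * (2 * t * pderivT lam t x + 1) - Λ * t ^ 2
      = 4 * Real.pi * t ^ 2 * (r t x + s t x)
  eqE2 : ∀ t ∈ J, ∀ x : ℝ,
    Real.exp (-2 * η t x) * (2 * t * pderivT η t x - 1) + Λ * t ^ 2
      = 4 * Real.pi * t ^ 2 * (r t x + s t x)
  eqE3 : ∀ t ∈ J, ∀ x : ℝ,
    pderivX η t x = -(2 * Real.pi * t * Real.exp (lam t x + η t x) * (r t x - s t x))
  eqE4 : ∀ t ∈ J, ∀ x : ℝ,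
    pderivT r t x + Real.exp (η t x - lam t x) * pderivX r t x
      = -2 * (pderivT lam t x + Real.exp (η t x - lam t x) * pderivX η t x + 1 / t) * r t x
        - 2 / t * Real.sqrt (r t x * s t x)
  eqE5 : ∀ t ∈ J, ∀ x : ℝ,
    pderivT s t x - Real.exp (η t x - lam t x) * pderivX s t x
      = -2 * (pderivT lam t x - Real.exp (η t x - lam t x) * pderivX η t x + 1 / t) * s t x
        - 2 / t * Real.sqrt (r t x * s t x)

/-- A function that is `C¹` on `[1,∞) × ℝ` has both partial derivatives at interior times. -/
lemma hasDerivAt_pderiv {f : ℝ → ℝ → ℝ}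
    (hf : ContDiffOn ℝ 1 (fun p : ℝ × ℝ => f p.1 p.2) (Ici 1 ×ˢ univ))
    {t : ℝ} (ht : 1 < t) (x : ℝ) :
    HasDerivAt (fun τ => f τ x) (pderivT f t x) t ∧
      HasDerivAt (fun y => f t y) (pderivX f t x) x := by
  have hd : DifferentiableAt ℝ (fun p : ℝ × ℝ => f p.1 p.2) (t, x) :=
    (hf.contDiffAt (prod_mem_nhds (Ici_mem_nhds ht) Filter.univ_mem)).differentiableAt (by simp)
  constructor
  · have h : DifferentiableAt ℝ (fun τ : ℝ => (τ, x)) t := by fun_prop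
    exact (hd.comp t h).hasDerivAt
  · have h : DifferentiableAt ℝ (fun y : ℝ => (t, y)) x := by fun_prop
    exact (hd.comp x h).hasDerivAt

/-- A continuous `1`-periodic function is bounded above by a nonnegative constant. -/
lemma exists_upper_bound_of_periodic {f : ℝ → ℝ} (hf : Continuous f)
    (hper : ∀ x, f (x + 1) = f x) : ∃ C, 0 ≤ C ∧ ∀ x, f x ≤ C := by
  obtain ⟨C, hC⟩ := (isCompact_Icc (a := (0 : ℝ)) (b := 1)).bddAbove_image hf.continuousOn
  refine ⟨max C 0, le_max_right _ _, fun x => ?_⟩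
  obtain ⟨y, hy, hxy⟩ := Function.Periodic.exists_mem_Ico₀ (f := f) hper one_pos x
  rw [hxy]
  exact (hC (mem_image_of_mem f (Ico_subset_Icc_self hy))).trans (le_max_left _ _)

/-- Weak maximum principle for subsolutions of a transport equation, periodic in space. -/
lemma le_of_transport_nonpos {F : ℝ → ℝ → ℝ} {a M : ℝ}
    (hcont : ContinuousOn (fun p : ℝ × ℝ => F p.1 p.2) (Ici a ×ˢ univ))
    (hper : ∀ t, a ≤ t → ∀ x, F t (x + 1) = F t x)
    (hder : ∀ t, a < t → ∀ x, ∃ p q c : ℝ, HasDerivAt (fun τ => F τ x) p t ∧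
      HasDerivAt (fun y => F t y) q x ∧ p + c * q ≤ 0)
    (hinit : ∀ x, F a x ≤ M) {t : ℝ} (ht : a ≤ t) (x : ℝ) : F t x ≤ M := by
  have key : ∀ ε : ℝ, 0 < ε → F t x ≤ M + ε * (t - a) := by
    intro ε hε
    have hG : ContinuousOn (fun p : ℝ × ℝ => F p.1 p.2 - ε * (p.1 - a))
        (Icc a t ×ˢ Icc (0 : ℝ) 1) :=
      (hcont.mono (prod_mono Icc_subset_Ici_self (subset_univ _))).sub (by fun_prop)
    obtain ⟨⟨b, y⟩, ⟨hb, -⟩, hmax⟩ := (isCompact_Icc.prod isCompact_Icc).exists_isMaxOn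
      ⟨(a, 0), ⟨left_mem_Icc.2 ht, by simp⟩⟩ hG
    have hmax' : ∀ τ ∈ Icc a t, ∀ z, F τ z - ε * (τ - a) ≤ F b y - ε * (b - a) := by
      intro τ hτ z
      obtain ⟨z', hz', hzz⟩ :=
        Function.Periodic.exists_mem_Ico₀ (f := F τ) (hper τ hτ.1) one_pos z
      rw [hzz]
      exact hmax (show (τ, z') ∈ Icc a t ×ˢ Icc (0 : ℝ) 1 from ⟨hτ, Ico_subset_Icc_self hz'⟩)
    have hba : b = a := by
      by_contra hne
      have hab : a < b := lt_of_le_of_ne hb.1 (Ne.symm hne)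
      obtain ⟨p, q, c, hp, hq, hpq⟩ := hder b hab y
      have hq0 : q = 0 := by
        refine IsLocalMax.hasDerivAt_eq_zero (Filter.Eventually.of_forall fun z => ?_) hq
        have := hmax' b hb z
        linarith
      have hG' : HasDerivAt (fun τ => F τ y - ε * (τ - a)) (p - ε * 1) b :=
        hp.sub (((hasDerivAt_id b).sub_const a).const_mul ε)
      have hlim := hG'.tendsto_slope.mono_left
        (nhdsWithin_mono b (fun z (hz : z ∈ Iio b) => ne_of_lt hz))
      have hnonneg : 0 ≤ p - ε * 1 := by
        refine ge_of_tendsto hlim ?_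
        filter_upwards [Ioo_mem_nhdsLT hab] with τ hτ
        rw [slope_def_field]
        refine div_nonneg_of_nonpos ?_ (by linarith [hτ.2])
        have := hmax' τ ⟨hτ.1.le, hτ.2.le.trans hb.2⟩ y
        linarith
      rw [hq0] at hpq
      linarith
    have h1 := hmax' t ⟨ht, le_rfl⟩ x
    have h2 := hinit y
    rw [hba] at h1
    linarith
  refine le_of_forall_pos_le_add fun δ hδ => (key (δ / (t - a + 1)) (by
    have : 0 < t - a + 1 := by linarith
    positivity)).trans ?_
  have hpos : 0 < t - a + 1 := by linarith
  have : δ / (t - a + 1) * (t - a) ≤ δ := by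
    rw [div_mul_eq_mul_div, div_le_iff₀ hpos]
    nlinarith
  linarith

namespace RegularSolution

variable {Λ : ℝ} (sol : RegularSolution Λ (Ici 1))

/-- The time derivative of `t e^{-2η}`, from (E2). -/
lemma hasDerivAt_mul_exp_neg {t : ℝ} (ht : 1 < t) (x : ℝ) :
    HasDerivAt (fun τ => τ * exp (-2 * sol.η τ x))
      (Λ * t ^ 2 - 4 * π * t ^ 2 * (sol.r t x + sol.s t x)) t := by
  have h := (hasDerivAt_id t).mul (((hasDerivAt_pderiv sol.η_c1 ht x).1.const_mul (-2)).exp)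
  refine h.congr_deriv ?_
  have h2 := sol.eqE2 t ht.le x
  simp only [id]
  linear_combination -h2

/-- A function that is `C¹` on `[1,∞) × ℝ` is continuous in space at each time. -/
lemma continuous_slice {f : ℝ → ℝ → ℝ}
    (hf : ContDiffOn ℝ 1 (fun p : ℝ × ℝ => f p.1 p.2) (Ici 1 ×ˢ univ)) {t : ℝ} (ht : 1 ≤ t) :
    Continuous (f t) :=
  hf.continuousOn.comp_continuous (f := fun y : ℝ => (t, y)) (by fun_prop) fun _ => ⟨ht, trivial⟩

/-- `t e^{-2η}` exceeds its de Sitter value `Λ t³ / 3` by at most a constant. -/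
lemma exists_mul_exp_neg_le :
    ∃ C, 0 ≤ C ∧ ∀ t, 2 ≤ t → ∀ x, t * exp (-2 * sol.η t x) ≤ Λ * t ^ 3 / 3 + C := by
  have hcont : Continuous fun x => 2 * exp (-2 * sol.η 2 x) - Λ * 2 ^ 3 / 3 := by
    have := continuous_slice sol.η_c1 (t := 2) (by norm_num)
    fun_prop
  obtain ⟨C, hC0, hC⟩ := exists_upper_bound_of_periodic hcont fun x => by
    rw [sol.η_per 2 (by norm_num) x]
  refine ⟨C, hC0, fun t ht x => ?_⟩
  have hd : ∀ τ : ℝ, 1 < τ → HasDerivAt (fun τ => τ * exp (-2 * sol.η τ x) - Λ * τ ^ 3 / 3)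
      (-(4 * π * τ ^ 2 * (sol.r τ x + sol.s τ x))) τ := by
    intro τ hτ
    refine ((sol.hasDerivAt_mul_exp_neg hτ x).sub
      (((hasDerivAt_pow 3 τ).const_mul Λ).div_const 3)).congr_deriv ?_
    norm_num
    ring
  have hanti : AntitoneOn (fun τ => τ * exp (-2 * sol.η τ x) - Λ * τ ^ 3 / 3) (Ici 2) := by
    refine antitoneOn_of_hasDerivWithinAt_nonpos (convex_Ici 2)
      (f' := fun τ => -(4 * π * τ ^ 2 * (sol.r τ x + sol.s τ x))) (fun τ hτ => ?_)
      (fun τ hτ => ?_) (fun τ hτ => ?_)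
    · exact (hd τ (by linarith [mem_Ici.1 hτ])).continuousAt.continuousWithinAt
    · rw [interior_Ici, mem_Ioi] at hτ
      exact (hd τ (by linarith)).hasDerivWithinAt
    · rw [interior_Ici, mem_Ioi] at hτ
      have h1 := sol.r_nonneg τ (by rw [mem_Ici]; linarith) x
      have h2 := sol.s_nonneg τ (by rw [mem_Ici]; linarith) x
      rw [neg_nonpos]
      positivity
  have h1 := hanti (mem_Ici.2 le_rfl) ht ht
  have h2 := hC x
  simp only at h1 h2
  linarith

/-- Decay of a matter density transported along null rays, as long as `Λ t² e^{2η} ≥ 2`. -/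
lemma exists_pow_four_mul_exp_le {t₀ : ℝ} (ht₀ : 2 ≤ t₀)
    (hu : ∀ t, t₀ ≤ t → ∀ x, 2 ≤ Λ * t ^ 2 * exp (2 * sol.η t x)) {f : ℝ → ℝ → ℝ} {σ : ℝ}
    (hf : ContDiffOn ℝ 1 (fun p : ℝ × ℝ => f p.1 p.2) (Ici 1 ×ˢ univ))
    (hper : ∀ t ∈ Ici (1 : ℝ), ∀ x, f t (x + 1) = f t x)
    (hnonneg : ∀ t ∈ Ici (1 : ℝ), ∀ x, 0 ≤ f t x)
    (heq : ∀ t, 1 < t → ∀ x,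
      pderivT f t x + σ * exp (sol.η t x - sol.lam t x) * pderivX f t x
        ≤ -2 * (pderivT sol.lam t x
          + σ * exp (sol.η t x - sol.lam t x) * pderivX sol.η t x + 1 / t) * f t x) :
    ∃ M, 0 ≤ M ∧ ∀ t, t₀ ≤ t → ∀ x, t ^ 4 * exp (2 * sol.η t x) * f t x ≤ M := by
  have hcont : Continuous fun x => t₀ ^ 4 * exp (2 * sol.η t₀ x) * f t₀ x := by
    have h1 := continuous_slice sol.η_c1 (t := t₀) (by linarith)
    have h2 := continuous_slice hf (t := t₀) (by linarith)
    fun_prop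
  have hper' : ∀ t, t₀ ≤ t → ∀ x, t ^ 4 * exp (2 * sol.η t (x + 1)) * f t (x + 1)
      = t ^ 4 * exp (2 * sol.η t x) * f t x := by
    intro t ht x
    have h1 : t ∈ Ici (1 : ℝ) := by rw [mem_Ici]; linarith
    rw [sol.η_per t h1, hper t h1]
  obtain ⟨M, hM0, hM⟩ := exists_upper_bound_of_periodic hcont (hper' t₀ le_rfl)
  refine ⟨M, hM0, fun t ht x => le_of_transport_nonpos
    (F := fun t x => t ^ 4 * exp (2 * sol.η t x) * f t x) ?_ hper' ?_ hM ht x⟩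
  · have hsub : Ici t₀ ×ˢ (univ : Set ℝ) ⊆ Ici 1 ×ˢ univ :=
      prod_mono (Ici_subset_Ici.2 (by linarith)) subset_rfl
    have h1 := sol.η_c1.continuousOn.mono hsub
    have h2 := hf.continuousOn.mono hsub
    fun_prop
  · intro t ht x
    have ht1 : 1 < t := by linarith
    have ht0 : 0 < t := by linarith
    obtain ⟨hηt, hηx⟩ := hasDerivAt_pderiv sol.η_c1 ht1 x
    obtain ⟨hft, hfx⟩ := hasDerivAt_pderiv hf ht1 x
    refine ⟨_, _, σ * exp (sol.η t x - sol.lam t x),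
      ((hasDerivAt_pow 4 t).mul (hηt.const_mul 2).exp).mul hft,
      ((hηx.const_mul 2).exp.const_mul (t ^ 4)).mul hfx, ?_⟩
    have hE1 := sol.eqE1 t ht1.le x
    have hE2 := sol.eqE2 t ht1.le x
    have hexp : exp (2 * sol.η t x) * exp (-2 * sol.η t x) = 1 := by
      rw [← exp_add]
      ring_nf
      exact exp_zero
    have hdiff : t * (pderivT sol.lam t x - pderivT sol.η t x) + 1
        = Λ * t ^ 2 * exp (2 * sol.η t x) := by
      linear_combination (exp (2 * sol.η t x) / 2) * (hE1 - hE2)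
        - (t * (pderivT sol.lam t x - pderivT sol.η t x) + 1) * hexp
    have hgap : 0 ≤ t * (pderivT sol.lam t x - pderivT sol.η t x) - 1 := by
      linarith [hu t ht.le x]
    have hfE : 0 ≤ t ^ 3 * exp (2 * sol.η t x) * f t x := by
      have := hnonneg t ht1.le x
      positivity
    have hmul := mul_le_mul_of_nonneg_left (heq t ht1 x)
      (show 0 ≤ t ^ 4 * exp (2 * sol.η t x) by positivity)
    have hprod := mul_nonneg hfE hgap
    have hinv : t ^ 4 * (1 / t) = t ^ 3 := by field_simp
    simp only [Pi.mul_apply, Nat.cast_ofNat, show 4 - 1 = 3 from rfl]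
    linear_combination hmul + 2 * hprod - 2 * exp (2 * sol.η t x) * f t x * hinv

/-- The spatially uniform late-time bounds on the metric and the matter densities. -/
lemma exists_late_time_bounds (hΛ : 0 < Λ) :
    ∃ t₀ C N D K : ℝ, 2 ≤ t₀ ∧ ∀ t, t₀ ≤ t → ∀ x,
      t * exp (-2 * sol.η t x) ≤ Λ * t ^ 3 / 3 + C ∧
      Λ * t ^ 3 / 3 - N * t - D ≤ t * exp (-2 * sol.η t x) ∧
      4 * π * t ^ 2 * (sol.r t x + sol.s t x) * exp (2 * sol.η t x) ≤ K / t ^ 2 := by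
  obtain ⟨C, hC0, hC⟩ := sol.exists_mul_exp_neg_le
  set t₀ : ℝ := max 2 (6 * C / Λ)
  have ht₀ : 2 ≤ t₀ := le_max_left _ _
  have hexp : ∀ t x, exp (2 * sol.η t x) * exp (-2 * sol.η t x) = 1 := by
    intro t x
    rw [← exp_add]
    ring_nf
    exact exp_zero
  have hw : ∀ t, t₀ ≤ t → ∀ x, t * exp (-2 * sol.η t x) ≤ Λ * t ^ 3 / 2 := by
    intro t ht x
    have h1 := hC t (ht₀.trans ht) x
    have h2 : 6 * C ≤ t * Λ := (div_le_iff₀ hΛ).1 ((le_max_right _ _).trans ht)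
    have h3 : t ≤ t ^ 3 := le_self_pow₀ (by linarith) (by norm_num)
    have h4 := mul_le_mul_of_nonneg_right h3 hΛ.le
    linarith
  have hu : ∀ t, t₀ ≤ t → ∀ x, 2 ≤ Λ * t ^ 2 * exp (2 * sol.η t x) := by
    intro t ht x
    have ht0 : 0 < t := by linarith
    have h1 := mul_le_mul_of_nonneg_right (hw t ht x) (exp_pos (2 * sol.η t x)).le
    have h2 : t * 2 ≤ t * (Λ * t ^ 2 * exp (2 * sol.η t x)) := by
      linear_combination 2 * h1 - 2 * t * hexp t x
    exact le_of_mul_le_mul_left h2 ht0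
  obtain ⟨M₁, hM₁0, hM₁⟩ := sol.exists_pow_four_mul_exp_le ht₀ hu (σ := 1) sol.r_c1 sol.r_per
    sol.r_nonneg fun t ht x => by
      have h1 := sol.eqE4 t ht.le x
      have h2 : 0 ≤ 2 / t * √(sol.r t x * sol.s t x) := by positivity
      linear_combination h1 + h2
  obtain ⟨M₂, hM₂0, hM₂⟩ := sol.exists_pow_four_mul_exp_le ht₀ hu (σ := -1) sol.s_c1 sol.s_per
    sol.s_nonneg fun t ht x => by
      have h1 := sol.eqE5 t ht.le x
      have h2 : 0 ≤ 2 / t * √(sol.r t x * sol.s t x) := by positivity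
      linear_combination h1 + h2
  set K : ℝ := 4 * π * (M₁ + M₂) with hK
  have hK0 : 0 ≤ K := by positivity
  have hρ : ∀ t, t₀ ≤ t → ∀ x,
      4 * π * t ^ 2 * (sol.r t x + sol.s t x) * exp (2 * sol.η t x) ≤ K / t ^ 2 := by
    intro t ht x
    have ht0 : 0 < t := by linarith
    rw [le_div_iff₀ (by positivity), hK]
    have := mul_le_mul_of_nonneg_left (add_le_add (hM₁ t ht x) (hM₂ t ht x))
      (show 0 ≤ 4 * π by positivity)
    linear_combination this
  have hmatter : ∀ t, t₀ ≤ t → ∀ x,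
      4 * π * t ^ 2 * (sol.r t x + sol.s t x) ≤ K * (Λ / 2) := by
    intro t ht x
    have ht0 : 0 < t := by linarith
    have h1 := mul_le_mul_of_nonneg_right ((le_div_iff₀ (by positivity)).1 (hρ t ht x))
      (mul_nonneg ht0.le (exp_pos (-2 * sol.η t x)).le)
    have h2 := mul_le_mul_of_nonneg_left (hw t ht x) hK0
    have h3 : t ^ 3 * (4 * π * t ^ 2 * (sol.r t x + sol.s t x)) ≤ t ^ 3 * (K * (Λ / 2)) := by
      linear_combination h1 + h2
        - t ^ 3 * (4 * π * t ^ 2 * (sol.r t x + sol.s t x)) * hexp t x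
    exact le_of_mul_le_mul_left h3 (by positivity)
  refine ⟨t₀, C, K * (Λ / 2), Λ * t₀ ^ 3 / 3, K, ht₀, fun t ht x =>
    ⟨hC t (ht₀.trans ht) x, ?_, hρ t ht x⟩⟩
  have hd : ∀ τ : ℝ, 1 < τ →
      HasDerivAt (fun τ => τ * exp (-2 * sol.η τ x) - Λ * τ ^ 3 / 3 + K * (Λ / 2) * τ)
        (K * (Λ / 2) - 4 * π * τ ^ 2 * (sol.r τ x + sol.s τ x)) τ := by
    intro τ hτ
    refine (((sol.hasDerivAt_mul_exp_neg hτ x).sub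
      (((hasDerivAt_pow 3 τ).const_mul Λ).div_const 3)).add
        ((hasDerivAt_id τ).const_mul (K * (Λ / 2)))).congr_deriv ?_
    norm_num
    ring
  have hmono : MonotoneOn
      (fun τ => τ * exp (-2 * sol.η τ x) - Λ * τ ^ 3 / 3 + K * (Λ / 2) * τ) (Ici t₀) := by
    refine monotoneOn_of_hasDerivWithinAt_nonneg (convex_Ici t₀)
      (f' := fun τ => K * (Λ / 2) - 4 * π * τ ^ 2 * (sol.r τ x + sol.s τ x)) (fun τ hτ => ?_)
      (fun τ hτ => ?_) (fun τ hτ => ?_)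
    · exact (hd τ (by linarith [mem_Ici.1 hτ])).continuousAt.continuousWithinAt
    · rw [interior_Ici, mem_Ioi] at hτ
      exact (hd τ (by linarith)).hasDerivWithinAt
    · rw [interior_Ici, mem_Ioi] at hτ
      exact sub_nonneg.2 (hmatter τ hτ.le x)
  have h1 := hmono (mem_Ici.2 le_rfl) ht ht
  have h2 : 0 ≤ t₀ * exp (-2 * sol.η t₀ x) := by positivity
  have h3 : 0 ≤ K * (Λ / 2) * t₀ := by positivity
  simp only at h1
  linarith

/-- `t ∂ₜλ → 1`, uniformly in space. -/
lemma eventually_abs_mul_pderivT_lam_sub_one_le (hΛ : 0 < Λ) {δ : ℝ} (hδ : 0 < δ) :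
    ∀ᶠ t in Filter.atTop, ∀ x, |t * pderivT sol.lam t x - 1| ≤ δ := by
  obtain ⟨t₀, C, N, D, K, ht₀, hb⟩ := sol.exists_late_time_bounds hΛ
  have hpow : ∀ (c : ℝ) {n : ℕ}, n ≠ 0 →
      Filter.Tendsto (fun t : ℝ => c / t ^ n) Filter.atTop (nhds 0) := fun c n hn =>
    tendsto_const_nhds.div_atTop (Filter.tendsto_pow_atTop hn)
  have hne : Λ / 3 ≠ 0 := by positivity
  have hlow : Filter.Tendsto (fun t : ℝ => Λ / 3 - N / t ^ 2 - D / t ^ 3) Filter.atTop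
      (nhds (Λ / 3)) := by
    simpa using (tendsto_const_nhds.sub (hpow N two_ne_zero)).sub (hpow D three_ne_zero)
  have hup : Filter.Tendsto (fun t : ℝ => Λ / 3 + C / t ^ 3) Filter.atTop (nhds (Λ / 3)) := by
    simpa using tendsto_const_nhds.add (hpow C three_ne_zero)
  have hthree : Λ / (Λ / 3) = 3 := by field_simp
  have hlow' : Filter.Tendsto (fun t : ℝ => Λ / (Λ / 3 - N / t ^ 2 - D / t ^ 3) + K / t ^ 2)
      Filter.atTop (nhds 3) := by
    simpa [hthree] using ((tendsto_const_nhds (x := Λ)).div hlow hne).add (hpow K two_ne_zero)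
  have hup' : Filter.Tendsto (fun t : ℝ => Λ / (Λ / 3 + C / t ^ 3)) Filter.atTop (nhds 3) := by
    have h := (tendsto_const_nhds (x := Λ)).div hup hne
    rwa [hthree] at h
  filter_upwards [Filter.eventually_ge_atTop t₀,
    hlow.eventually_const_lt (by positivity : 0 < Λ / 3),
    hlow'.eventually_le_const (by linarith : 3 < 3 + 2 * δ),
    hup'.eventually_const_le (by linarith : 3 - 2 * δ < 3)] with t ht hpos hle hge x
  obtain ⟨hC, hD, hK⟩ := hb t ht x
  have ht0 : 0 < t := by linarith
  set E := exp (2 * sol.η t x) with hE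
  have hE0 : 0 < E := exp_pos _
  have hexp : E * exp (-2 * sol.η t x) = 1 := by
    rw [hE, ← exp_add]
    ring_nf
    exact exp_zero
  have hr := sol.r_nonneg t (by rw [mem_Ici]; linarith) x
  have hs := sol.s_nonneg t (by rw [mem_Ici]; linarith) x
  have hρ0 : 0 ≤ 4 * π * t ^ 2 * (sol.r t x + sol.s t x) * E := by positivity
  have hlam : 2 * (t * pderivT sol.lam t x) + 1
      = Λ * t ^ 2 * E + 4 * π * t ^ 2 * (sol.r t x + sol.s t x) * E := by
    linear_combination E * sol.eqE1 t (by rw [mem_Ici]; linarith) x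
      - (2 * (t * pderivT sol.lam t x) + 1) * hexp
  have hquot : Λ * t ^ 2 * E = Λ / (t * exp (-2 * sol.η t x) / t ^ 3) := by
    have hpos' : 0 < exp (-2 * sol.η t x) := exp_pos _
    generalize exp (-2 * sol.η t x) = G at hexp hpos'
    field_simp
    linear_combination hexp
  have hCdiv : t * exp (-2 * sol.η t x) / t ^ 3 ≤ Λ / 3 + C / t ^ 3 := by
    rw [div_le_iff₀ (by positivity)]
    refine hC.trans_eq ?_
    field_simp
  have hDdiv : Λ / 3 - N / t ^ 2 - D / t ^ 3 ≤ t * exp (-2 * sol.η t x) / t ^ 3 := by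
    rw [le_div_iff₀ (by positivity)]
    refine Eq.trans_le ?_ hD
    field_simp
  have hu1 := div_le_div_of_nonneg_left hΛ.le hpos hDdiv
  have hu2 := div_le_div_of_nonneg_left hΛ.le (hpos.trans_le hDdiv) hCdiv
  rw [abs_le]
  constructor <;> linarith

end RegularSolution

/-- The generalized Kasner exponents tend to `1/3` uniformly in `x` (Theorem 4.1). -/
theorem kasner_exponents_limit (Λ : ℝ) (hΛ : 0 < Λ)
    (sol : RegularSolution Λ (Set.Ici 1)) :
    ∀ ε : ℝ, 0 < ε → ∃ t₀ : ℝ, 1 ≤ t₀ ∧ ∀ t : ℝ, t₀ ≤ t → ∀ x : ℝ,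
      |t * pderivT sol.lam t x / (t * pderivT sol.lam t x + 2) - 1 / 3| ≤ ε ∧
      |1 / (t * pderivT sol.lam t x + 2) - 1 / 3| ≤ ε := by
  intro ε hε
  obtain ⟨t₀, ht₀⟩ := Filter.eventually_atTop.1
    (sol.eventually_abs_mul_pderivT_lam_sub_one_le hΛ
      (show 0 < min ε (1 / 2) from lt_min hε (by norm_num)))
  refine ⟨max 1 t₀, le_max_left _ _, fun t ht x => ?_⟩
  have h := ht₀ t ((le_max_right _ _).trans ht) x
  set L := t * pderivT sol.lam t x
  have hε' := h.trans (min_le_left _ _)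
  have hL : 0 < L + 2 := by linarith [(abs_le.1 (h.trans (min_le_right _ _))).1]
  have hL' : 1 ≤ L + 2 := by linarith [(abs_le.1 (h.trans (min_le_right _ _))).1]
  have h1 : L / (L + 2) - 1 / 3 = 2 / 3 * (L - 1) / (L + 2) := by
    field_simp
    ring
  have h2 : 1 / (L + 2) - 1 / 3 = -(1 / 3 * (L - 1)) / (L + 2) := by
    field_simp
    ring
  rw [h1, h2, abs_div, abs_div, abs_neg, abs_mul, abs_mul, abs_of_pos hL]
  norm_num
  rw [div_le_iff₀ hL, div_le_iff₀ hL]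
  constructor <;> nlinarith [abs_nonneg (L - 1)]
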